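/- Let ϑ > 0, γ̃ ∈ (0, 1/2), and let g : [0,∞)×[0,1] → ℝ be continuous with g(s,0) = g(s,1) = 0 for all s and with sup_{s,x} |g(s,x)| ≤ B and |g(s,x) − g(s,y)| ≤ B·|x − y|^{γ̃} for all s ≥ 0 and x, y ∈ [0,1]. Then for every γ ∈ (0, γ̃) there exists a constant C > 0, depending only on γ, γ̃ and ϑ, such that for every t ≥ 0 the map x ↦ N(t,x) is twice continuously differentiable on (0,1) and its second derivative satisfies |∂²ₓN(t,x)| ≤ C·B and |∂²ₓN(t,x) − ∂²ₓN(t,y)| ≤ C·B·|x − y|^γ for all x, y ∈ (0,1); in particular N(t,·) belongs to C^{2+γ} with norm bounded uniformly in t. -/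

import Mathlib

open Real MeasureTheory

/-- The sine basis functions `e_ℓ(x) = √2 sin(πℓx)`. -/
noncomputable def sineB (ℓ : ℕ) (x : ℝ) : ℝ := Real.sqrt 2 * Real.sin (Real.pi * ℓ * x)

/-- Fourier sine coefficients `c_ℓ(s) = ∫₀¹ g(s,y) e_ℓ(y) dy`. -/
noncomputable def fCoef (g : ℝ → ℝ → ℝ) (ℓ : ℕ) (s : ℝ) : ℝ :=
  ∫ y in (0 : ℝ)..1, g s y * sineB ℓ y

/-- The heat convolution `N(t,x) = ∫₀ᵗ ∑_{ℓ≥1} e^{−λ_ℓ(t−s)} c_ℓ(s) e_ℓ(x) ds`,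
where `λ_ℓ = ϑπ²ℓ²`. -/
noncomputable def heatConv (ϑ : ℝ) (g : ℝ → ℝ → ℝ) (t x : ℝ) : ℝ :=
  ∫ s in (0 : ℝ)..t,
    ∑' ℓ : ℕ, Real.exp (-(ϑ * Real.pi ^ 2 * ((ℓ : ℝ) + 1) ^ 2 * (t - s)))
      * fCoef g (ℓ + 1) s * sineB (ℓ + 1) x

noncomputable def psi (u : ℝ) : ℝ := (4 * π ^ 2 * u ^ 2 - 2 * π) * Real.exp (-π * u ^ 2)

lemma int_pow_gauss (n : ℕ) : Integrable (fun u : ℝ => u ^ n * Real.exp (-π * u ^ 2)) := by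
  have := integrable_rpow_mul_exp_neg_mul_sq Real.pi_pos (s := (n : ℝ))
    (by have : (0 : ℝ) ≤ n := n.cast_nonneg
        linarith)
  simpa [Real.rpow_natCast] using this

lemma psi_cont : Continuous psi := by unfold psi; fun_prop

lemma psi_mul_int {α : ℝ} (h0 : 0 ≤ α) (h1 : α ≤ 2) :
    Integrable (fun u : ℝ => |psi u| * |u| ^ α) := by
  have hb : Integrable (fun u : ℝ => 4 * π ^ 2 * (u ^ 2 * Real.exp (-π * u ^ 2))
      + 4 * π ^ 2 * (u ^ 4 * Real.exp (-π * u ^ 2)) + 2 * π * (u ^ 0 * Real.exp (-π * u ^ 2))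
      + 2 * π * (u ^ 2 * Real.exp (-π * u ^ 2))) :=
    ((((int_pow_gauss 2).const_mul _).add ((int_pow_gauss 4).const_mul _)).add
      ((int_pow_gauss 0).const_mul _)).add ((int_pow_gauss 2).const_mul _)
  refine hb.mono' ?_ (Filter.Eventually.of_forall fun u => ?_)
  · exact (psi_cont.abs.mul (continuous_abs.rpow_const (fun _ => Or.inr h0))).aestronglyMeasurable
  · have hu : |u| ^ α ≤ 1 + u ^ 2 := by
      rcases le_total |u| 1 with h | h
      · have := Real.rpow_le_one (abs_nonneg u) h h0
        nlinarith [sq_nonneg u]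
      · have := Real.rpow_le_rpow_of_exponent_le h h1
        rw [Real.rpow_two, sq_abs] at this
        linarith
    have hp : |psi u| ≤ (4 * π ^ 2 * u ^ 2 + 2 * π) * Real.exp (-π * u ^ 2) := by
      unfold psi
      rw [abs_mul, abs_of_pos (Real.exp_pos _)]
      gcongr
      have := Real.pi_pos
      rw [abs_le]; constructor <;> nlinarith [mul_nonneg (sq_nonneg π) (sq_nonneg u)]
    rw [Real.norm_of_nonneg (by positivity)]
    calc |psi u| * |u| ^ α ≤ ((4 * π ^ 2 * u ^ 2 + 2 * π) * Real.exp (-π * u ^ 2)) * (1 + u ^ 2) := by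
          gcongr
      _ = _ := by ring

lemma psi_int : Integrable psi := by
  have := psi_mul_int (α := 0) le_rfl (by norm_num)
  simp only [Real.rpow_zero, mul_one] at this
  exact (integrable_norm_iff psi_cont.aestronglyMeasurable).1 this

lemma psi_fourier (ξ : ℝ) :
    ∫ u : ℝ, Complex.exp (↑(-2 * π * u * ξ) * Complex.I) * (psi u : ℂ)
      = ((-(4 * π ^ 2 * ξ ^ 2 * Real.exp (-π * ξ ^ 2)) : ℝ) : ℂ) := by
  set f : ℝ → ℂ := fun u => ((Real.exp (-π * u ^ 2) : ℝ) : ℂ) with hf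
  set f1 : ℝ → ℂ := fun u => ((-2 * π * (u * Real.exp (-π * u ^ 2)) : ℝ) : ℂ) with hf1
  set f2 : ℝ → ℂ := fun u => ((psi u : ℝ) : ℂ) with hf2
  have d1 : ∀ u, HasDerivAt f (f1 u) u := by
    intro u
    refine HasDerivAt.ofReal_comp ?_
    have := ((hasDerivAt_pow 2 u).const_mul (-π)).exp
    convert this using 1
    push_cast; ring
  have d2 : ∀ u, HasDerivAt f1 (f2 u) u := by
    intro u
    suffices key : HasDerivAt (fun u : ℝ => -2 * π * (u * Real.exp (-π * u ^ 2))) (psi u) u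
      from HasDerivAt.ofReal_comp key
    have := ((hasDerivAt_id' u).mul ((hasDerivAt_pow 2 u).const_mul (-π)).exp).const_mul (-2 * π)
    refine HasDerivAt.congr_deriv this ?_
    unfold psi; push_cast; ring
  have e1 : deriv f = f1 := funext fun u => (d1 u).deriv
  have e2 : deriv f1 = f2 := funext fun u => (d2 u).deriv
  have i0 : Integrable f := by
    have := (int_pow_gauss 0).ofReal (𝕜 := ℂ)
    simpa [hf] using this
  have i1 : Integrable f1 := by
    have := ((int_pow_gauss 1).const_mul (-2 * π)).ofReal (𝕜 := ℂ)
    simpa [hf1] using this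
  have i2 : Integrable f2 := psi_int.ofReal
  have F1 := Real.fourier_deriv i0 (fun u => (d1 u).differentiableAt) (by rw [e1]; exact i1)
  have F2 := Real.fourier_deriv i1 (fun u => (d2 u).differentiableAt) (by rw [e2]; exact i2)
  rw [e1] at F1
  rw [e2, F1] at F2
  have F0 : FourierTransform.fourier f = fun t : ℝ => ((Real.exp (-π * t ^ 2) : ℝ) : ℂ) := by
    have := fourier_gaussian_pi (b := 1) (by simp)
    convert this using 2
    · simp [hf]
    · simp
  rw [F0] at F2
  have := congrFun F2 ξ
  rw [Real.fourier_real_eq_integral_exp_smul] at this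
  simp only [smul_eq_mul] at this
  rw [this]
  push_cast
  ring_nf
  simp


lemma conv_cont [Fact ((0 : ℝ) < 2)] (F : C(AddCircle (2 : ℝ), ℂ)) (b : ℝ) :
    Continuous (fun x : AddCircle (2 : ℝ) =>
      ∫ u : ℝ, (psi u : ℂ) * F (x - ((b * u : ℝ) : AddCircle (2 : ℝ)))) := by
  have hq : Continuous (fun u : ℝ => ((b * u : ℝ) : AddCircle (2 : ℝ))) :=
    (AddCircle.continuous_mk' 2).comp (continuous_const.mul continuous_id)
  have hp : Continuous (fun u : ℝ => (psi u : ℂ)) := Complex.continuous_ofReal.comp psi_cont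
  refine continuous_of_dominated (bound := fun u => ‖psi u‖ * ‖F‖) ?_ ?_ ?_ ?_
  · intro x
    exact (hp.mul (F.continuous.comp (continuous_const.sub hq))).aestronglyMeasurable
  · intro x
    refine Filter.Eventually.of_forall fun u => ?_
    rw [norm_mul, Complex.norm_real]
    gcongr
    exact F.norm_coe_le_norm _
  · exact psi_int.norm.mul_const _
  · refine Filter.Eventually.of_forall fun u => ?_
    exact continuous_const.mul (F.continuous.comp (continuous_id.sub continuous_const))

lemma conv_coeff [Fact ((0 : ℝ) < 2)] (F : C(AddCircle (2 : ℝ), ℂ)) (b : ℝ) (n : ℤ) :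
    fourierCoeff (fun x : AddCircle (2 : ℝ) =>
      ∫ u : ℝ, (psi u : ℂ) * F (x - ((b * u : ℝ) : AddCircle (2 : ℝ)))) n
    = ((-(4 * π ^ 2 * (n * b / 2) ^ 2 * Real.exp (-π * (n * b / 2) ^ 2)) : ℝ) : ℂ)
      * fourierCoeff F n := by
  have hq : Continuous (fun u : ℝ => ((b * u : ℝ) : AddCircle (2 : ℝ))) :=
    (AddCircle.continuous_mk' 2).comp (continuous_const.mul continuous_id)
  have hp : Continuous (fun u : ℝ => (psi u : ℂ)) := Complex.continuous_ofReal.comp psi_cont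
  unfold fourierCoeff
  simp only [smul_eq_mul]
  have e1 : ∀ x : AddCircle (2 : ℝ), fourier (-n) x *
      ∫ u : ℝ, (psi u : ℂ) * F (x - ((b * u : ℝ) : AddCircle (2 : ℝ)))
      = ∫ u : ℝ, fourier (-n) x * ((psi u : ℂ) * F (x - ((b * u : ℝ) : AddCircle (2 : ℝ)))) :=
    fun x => (integral_const_mul _ _).symm
  simp_rw [e1]
  rw [integral_integral_swap]
  · rw [← psi_fourier, ← integral_mul_const]
    congr 1
    ext u
    have := integral_sub_right_eq_self (μ := AddCircle.haarAddCircle)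
      (fun x : AddCircle (2 : ℝ) => fourier (-n) (x + ((b * u : ℝ) : AddCircle (2 : ℝ))) *
        ((psi u : ℂ) * F x)) ((b * u : ℝ) : AddCircle (2 : ℝ))
    simp only [sub_add_cancel] at this
    rw [this, ← integral_const_mul]
    congr 1
    ext x
    have h1 : fourier (-n) (x + ((b * u : ℝ) : AddCircle (2 : ℝ)))
        = fourier (-n) x * fourier (-n) ((b * u : ℝ) : AddCircle (2 : ℝ)) := by
      simp only [fourier_apply, smul_add, AddCircle.toCircle_add, Circle.coe_mul]
    have h2 : fourier (-n) ((b * u : ℝ) : AddCircle (2 : ℝ))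
        = Complex.exp (↑(-2 * π * u * (↑n * b / 2)) * Complex.I) := by
      rw [fourier_coe_apply]
      congr 1
      push_cast
      ring
    rw [h1, h2]
    ring
  · refine Integrable.mono' (g := fun z => ‖psi z.2‖ * ‖F‖) ?_ ?_ ?_
    · have := (integrable_const (μ := AddCircle.haarAddCircle (T := 2)) (1 : ℝ)).mul_prod
        (psi_int.norm.mul_const ‖F‖)
      simpa using this
    · refine Continuous.aestronglyMeasurable ?_
      exact ((map_continuous (fourier (-n))).comp continuous_fst).mul
        ((hp.comp continuous_snd).mul
          (F.continuous.comp (continuous_fst.sub (hq.comp continuous_snd))))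
    · refine Filter.Eventually.of_forall fun z => ?_
      simp only [Function.uncurry, norm_mul, Complex.norm_real]
      have h1 : ‖fourier (-n) z.1‖ = 1 := by rw [fourier_apply]; exact Circle.norm_coe _
      rw [h1, one_mul]
      gcongr
      exact F.norm_coe_le_norm _


noncomputable def oext (f : ℝ → ℝ) (x : ℝ) : ℝ :=
  if Even ⌊x⌋ then f (Int.fract x) else - f (1 - Int.fract x)

lemma oext_periodic (f : ℝ → ℝ) : Function.Periodic (oext f) 2 := by
  intro x
  have h1 : ⌊x + 2⌋ = ⌊x⌋ + 2 := by exact_mod_cast Int.floor_add_intCast x 2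
  have h2 : Int.fract (x + 2) = Int.fract x := by exact_mod_cast Int.fract_add_intCast x 2
  have h3 : Even (⌊x⌋ + 2) ↔ Even ⌊x⌋ := by rw [Int.even_add]; simp
  simp only [oext, h1, h2, h3]

lemma oext_of_mem {f : ℝ → ℝ} (h1 : f 1 = 0) {x : ℝ}
    (hx : x ∈ Set.Icc (0 : ℝ) 1) : oext f x = f x := by
  rcases eq_or_lt_of_le hx.2 with h | h
  · subst h; simp [oext, h1]
  · have hf : ⌊x⌋ = 0 := Int.floor_eq_zero_iff.2 ⟨hx.1, h⟩
    have : Int.fract x = x := Int.fract_eq_self.2 ⟨hx.1, h⟩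
    simp [oext, hf, this]

lemma oext_of_mem_neg {f : ℝ → ℝ} (h0 : f 0 = 0) {x : ℝ}
    (hx : x ∈ Set.Icc (-1 : ℝ) 0) : oext f x = - f (-x) := by
  rcases eq_or_lt_of_le hx.2 with h | h
  · subst h; simp [oext, h0]
  · have hf : ⌊x⌋ = -1 := Int.floor_eq_iff.2 ⟨by simpa using hx.1, by simpa using h⟩
    have : Int.fract x = x + 1 := by rw [Int.fract, hf]; simp
    rw [oext, hf, this, if_neg (by decide)]
    congr 2; ring

section
variable {f : ℝ → ℝ} {B a : ℝ}

lemma oext_right (ha : 0 < a) (hB : 0 ≤ B) (h0 : f 0 = 0) (h1 : f 1 = 0)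
    (hf : ∀ x ∈ Set.Icc (0 : ℝ) 1, ∀ y ∈ Set.Icc (0 : ℝ) 1, |f x - f y| ≤ B * |x - y| ^ a)
    (x : ℝ) (z : ℝ) (hz : ⌊x⌋ + 1 ≤ z) : |oext f x| ≤ B * |x - z| ^ a := by
  have hp := Int.fract_nonneg x
  have hp1 := (Int.fract_lt_one x).le
  have hxx := Int.self_sub_floor x
  have hle : 1 - Int.fract x ≤ |x - z| := by rw [abs_sub_comm]; refine le_trans ?_ (le_abs_self _); linarith
  have key : |oext f x| ≤ B * (1 - Int.fract x) ^ a := by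
    unfold oext
    split_ifs
    · have := hf (Int.fract x) ⟨hp, hp1⟩ 1 (by simp)
      rwa [h1, sub_zero, abs_sub_comm, abs_of_nonneg (by linarith : 0 ≤ 1 - Int.fract x)] at this
    · have := hf (1 - Int.fract x) ⟨by linarith, by linarith⟩ 0 (by simp)
      rwa [h0, sub_zero, sub_zero, abs_of_nonneg (by linarith : 0 ≤ 1 - Int.fract x), ← abs_neg] at this
  refine key.trans ?_
  gcongr

lemma oext_left (ha : 0 < a) (hB : 0 ≤ B) (h0 : f 0 = 0) (h1 : f 1 = 0)
    (hf : ∀ x ∈ Set.Icc (0 : ℝ) 1, ∀ y ∈ Set.Icc (0 : ℝ) 1, |f x - f y| ≤ B * |x - y| ^ a)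
    (x : ℝ) (z : ℝ) (hz : z ≤ ⌊x⌋) : |oext f x| ≤ B * |x - z| ^ a := by
  have hp := Int.fract_nonneg x
  have hp1 := (Int.fract_lt_one x).le
  have hxx := Int.self_sub_floor x
  have hle : Int.fract x ≤ |x - z| := by refine le_trans ?_ (le_abs_self _); linarith
  have key : |oext f x| ≤ B * (Int.fract x) ^ a := by
    unfold oext
    split_ifs
    · have := hf (Int.fract x) ⟨hp, hp1⟩ 0 (by simp)
      rwa [h0, sub_zero, sub_zero, abs_of_nonneg hp] at this
    · have := hf (1 - Int.fract x) ⟨by linarith, by linarith⟩ 1 (by simp)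
      rwa [h1, sub_zero, abs_sub_comm, sub_sub_cancel, abs_of_nonneg hp, ← abs_neg] at this
  refine key.trans ?_
  gcongr

lemma oext_holder (ha : 0 < a) (hB : 0 ≤ B) (h0 : f 0 = 0) (h1 : f 1 = 0)
    (hf : ∀ x ∈ Set.Icc (0 : ℝ) 1, ∀ y ∈ Set.Icc (0 : ℝ) 1, |f x - f y| ≤ B * |x - y| ^ a)
    (x y : ℝ) : |oext f x - oext f y| ≤ 2 * B * |x - y| ^ a := by
  have main : ∀ x y : ℝ, ⌊x⌋ < ⌊y⌋ → |oext f x - oext f y| ≤ 2 * B * |x - y| ^ a := by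
    intro x y h
    have hy := Int.floor_le y
    have hx := Int.lt_floor_add_one x
    have hh : (⌊x⌋ : ℝ) + 1 ≤ ⌊y⌋ := by exact_mod_cast h
    have b1 := oext_right ha hB h0 h1 hf x y (by linarith)
    have b2 := oext_left ha hB h0 h1 hf y x (by
      linarith)
    rw [abs_sub_comm y x] at b2
    have := abs_sub (oext f x) (oext f y)
    linarith
  rcases lt_trichotomy ⌊x⌋ ⌊y⌋ with h | h | h
  · exact main x y h
  · have hfr : Int.fract x - Int.fract y = x - y := by simp only [Int.fract, h]; ring
    have hx : Int.fract x ∈ Set.Icc (0 : ℝ) 1 := ⟨Int.fract_nonneg x, (Int.fract_lt_one x).le⟩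
    have hy : Int.fract y ∈ Set.Icc (0 : ℝ) 1 := ⟨Int.fract_nonneg y, (Int.fract_lt_one y).le⟩
    have hpos : 0 ≤ B * |x - y| ^ a := by positivity
    suffices |oext f x - oext f y| ≤ B * |x - y| ^ a by linarith
    unfold oext
    rw [h]
    split_ifs
    · rw [← hfr]; exact hf _ hx _ hy
    · have := hf (1 - Int.fract x) ⟨by linarith [hx.2], by linarith [hx.1]⟩
        (1 - Int.fract y) ⟨by linarith [hy.2], by linarith [hy.1]⟩
      rw [show 1 - Int.fract x - (1 - Int.fract y) = -(x - y) by rw [← hfr]; ring, abs_neg] at this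
      rw [show -f (1 - Int.fract x) - -f (1 - Int.fract y)
        = -(f (1 - Int.fract x) - f (1 - Int.fract y)) by ring, abs_neg]
      exact this
  · have := main y x h
    rwa [abs_sub_comm, abs_sub_comm y x] at this

lemma oext_cont (ha : 0 < a) (hB : 0 ≤ B) (h0 : f 0 = 0) (h1 : f 1 = 0)
    (hf : ∀ x ∈ Set.Icc (0 : ℝ) 1, ∀ y ∈ Set.Icc (0 : ℝ) 1, |f x - f y| ≤ B * |x - y| ^ a) :
    Continuous (oext f) := by
  rw [continuous_iff_continuousAt]
  intro x
  rw [ContinuousAt, tendsto_iff_dist_tendsto_zero]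
  have hc : Continuous (fun y : ℝ => 2 * B * |y - x| ^ a) :=
    continuous_const.mul (((continuous_id.sub continuous_const).abs).rpow_const
      (fun _ => Or.inr ha.le))
  have ht := hc.tendsto x
  simp only [sub_self, abs_zero, Real.zero_rpow ha.ne', mul_zero] at ht
  exact squeeze_zero (fun _ => dist_nonneg) (fun y => oext_holder ha hB h0 h1 hf y x) ht

end


lemma summable_gauss (k : ℕ) {q : ℝ} (hq : 0 < q) :
    Summable (fun n : ℕ => (n : ℝ) ^ k * Real.exp (-q * (n : ℝ) ^ 2)) := by
  refine Summable.of_nonneg_of_le (fun n => by positivity) (fun n => ?_)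
    (Real.summable_pow_mul_exp_neg_nat_mul k hq)
  refine mul_le_mul_of_nonneg_left (Real.exp_le_exp.2 ?_) (by positivity)
  have : (n : ℝ) ≤ (n : ℝ) ^ 2 := by
    exact_mod_cast Nat.le_self_pow two_ne_zero n
  nlinarith

noncomputable def circF (G : ℝ → ℝ) (hp : Function.Periodic G 2) (hc : Continuous G) :
    C(AddCircle (2 : ℝ), ℂ) where
  toFun := Function.Periodic.lift (f := fun x => (G x : ℂ)) (c := (2 : ℝ))
    (fun x => by simp [hp x])
  continuous_toFun := continuous_coinduced_dom.mpr (Complex.continuous_ofReal.comp hc)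

lemma circF_coe (G : ℝ → ℝ) (hp : Function.Periodic G 2) (hc : Continuous G) (x : ℝ) :
    circF G hp hc (x : AddCircle (2 : ℝ)) = (G x : ℂ) := rfl

lemma circF_coeff [Fact ((0 : ℝ) < 2)] {f : ℝ → ℝ} (h0 : f 0 = 0) (h1 : f 1 = 0)
    (hc : Continuous (oext f)) (n : ℤ) :
    fourierCoeff (circF (oext f) (oext_periodic f) hc) n
      = - Complex.I * ((∫ y in (0 : ℝ)..1, f y * Real.sin (π * n * y) : ℝ) : ℂ) := by
  rw [fourierCoeff_eq_intervalIntegral _ n (-1)]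
  simp only [circF_coe]
  rw [show (-1 : ℝ) + 2 = 1 by norm_num]
  have hint : ∀ p q : ℝ, IntervalIntegrable
      (fun x : ℝ => fourier (-n) (x : AddCircle (2 : ℝ)) • (oext f x : ℂ)) volume p q := by
    intro p q
    refine Continuous.intervalIntegrable ?_ _ _
    exact ((map_continuous (fourier (-n))).comp (AddCircle.continuous_mk' 2)).smul
      (Complex.continuous_ofReal.comp hc)
  have hi : ∀ p q : ℝ, IntervalIntegrable
      (fun x : ℝ => fourier (-n) ((-x : ℝ) : AddCircle (2 : ℝ)) • (oext f (-x) : ℂ)) volume p q := by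
    intro p q
    refine Continuous.intervalIntegrable ?_ _ _
    exact ((map_continuous (fourier (-n))).comp ((AddCircle.continuous_mk' 2).comp continuous_neg)).smul
      (Complex.continuous_ofReal.comp (hc.comp continuous_neg))
  rw [← intervalIntegral.integral_add_adjacent_intervals (hint (-1) 0) (hint 0 1)]
  have e := intervalIntegral.integral_comp_neg (a := 0) (b := 1)
    (fun x : ℝ => fourier (-n) (x : AddCircle (2 : ℝ)) • (oext f x : ℂ))
  rw [neg_zero] at e
  rw [← e, ← intervalIntegral.integral_add (hi 0 1) (hint 0 1),
    ← intervalIntegral.integral_ofReal, ← intervalIntegral.integral_const_mul,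
    ← intervalIntegral.integral_smul]
  refine intervalIntegral.integral_congr fun x hx => ?_
  rw [Set.uIcc_of_le zero_le_one] at hx
  have g1 : oext f x = f x := oext_of_mem h1 hx
  have g2 : oext f (-x) = - f x := by
    rw [oext_of_mem_neg h0 ⟨by linarith [hx.2], by linarith [hx.1]⟩, neg_neg]
  have k1 : fourier (-n) (x : AddCircle (2 : ℝ)) = Complex.exp (-(π * n * x : ℂ) * Complex.I) := by
    rw [fourier_coe_apply]; congr 1; push_cast; ring
  have k2 : fourier (-n) ((-x : ℝ) : AddCircle (2 : ℝ)) = Complex.exp ((π * n * x : ℂ) * Complex.I) := by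
    rw [fourier_coe_apply]; congr 1; push_cast; ring
  rw [k1, k2, g1, g2]
  simp only [smul_eq_mul]
  push_cast
  rw [Complex.sin]
  simp only [Complex.real_smul]
  push_cast
  linear_combination (1 / 2 : ℂ) * (f x : ℂ) * (Complex.exp (-(π * n * x : ℂ) * Complex.I) - Complex.exp ((π * n * x : ℂ) * Complex.I)) * Complex.I_sq

lemma circF_coeff_bound [Fact ((0 : ℝ) < 2)] (F : C(AddCircle (2 : ℝ), ℂ)) (n : ℤ) :
    ‖fourierCoeff F n‖ ≤ ‖F‖ := by
  unfold fourierCoeff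
  refine (norm_integral_le_of_norm_le_const (C := ‖F‖) ?_).trans (by simp)
  refine Filter.Eventually.of_forall fun z => ?_
  have h1 : ‖fourier (-n) z‖ = 1 := by rw [fourier_apply]; exact Circle.norm_coe _
  rw [norm_smul, h1, one_mul]
  exact F.norm_coe_le_norm _

lemma heat_id {f : ℝ → ℝ} (h0 : f 0 = 0) (h1 : f 1 = 0)
    (hc : Continuous (oext f)) {b : ℝ} (hb : 0 < b) (x : ℝ) :
    HasSum (fun ℓ : ℕ => -((π * (ℓ + 1)) ^ 2 * Real.exp (-π * ((ℓ + 1) * b / 2) ^ 2))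
        * (∫ y in (0 : ℝ)..1, f y * sineB (ℓ + 1) y) * sineB (ℓ + 1) x)
      ((b ^ 2)⁻¹ * ∫ u : ℝ, psi u * oext f (x - b * u)) := by
  have : Fact ((0 : ℝ) < 2) := ⟨two_pos⟩
  set F := circF (oext f) (oext_periodic f) hc with hF
  set W : C(AddCircle (2 : ℝ), ℂ) := ⟨_, conv_cont F b⟩ with hW
  have hco : ∀ n, fourierCoeff W n = _ := fun n => conv_coeff F b n
  have hsN : Summable (fun n : ℕ => (4 * π ^ 2 * (b / 2) ^ 2 * ‖F‖)
      * ((n : ℝ) ^ 2 * Real.exp (-(π * (b / 2) ^ 2) * (n : ℝ) ^ 2))) :=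
    (summable_gauss 2 (by positivity)).mul_left _
  have hbd : ∀ n : ℤ, ‖fourierCoeff W n‖ ≤ (4 * π ^ 2 * (b / 2) ^ 2 * ‖F‖)
      * ((n : ℝ) ^ 2 * Real.exp (-(π * (b / 2) ^ 2) * (n : ℝ) ^ 2)) := by
    intro n
    rw [hco, norm_mul, Complex.norm_real, norm_neg, Real.norm_of_nonneg (by positivity)]
    have := circF_coeff_bound F n
    calc _ ≤ 4 * π ^ 2 * (n * b / 2) ^ 2 * Real.exp (-π * (n * b / 2) ^ 2) * ‖F‖ := by gcongr
      _ = _ := by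
        rw [show -π * (n * b / 2) ^ 2 = -(π * (b / 2) ^ 2) * (n : ℝ) ^ 2 by ring]; ring
  have hs : Summable (fourierCoeff W) := by
    refine Summable.of_norm_bounded (Summable.of_nat_of_neg ?_ ?_) hbd
    · simpa using hsN
    · simpa using hsN
  have H := (has_pointwise_sum_fourier_series_of_summable hs (x : AddCircle (2 : ℝ))).nat_add_neg
  have H0 : fourierCoeff W 0 = 0 := by rw [hco]; simp
  rw [H0, zero_smul, add_zero] at H
  rw [← hasSum_nat_add_iff' 1] at H
  simp only [Finset.range_one, Finset.sum_singleton, Nat.cast_zero, neg_zero, H0, zero_smul,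
    add_zero, sub_zero] at H
  have hWx : W (x : AddCircle (2 : ℝ)) = ((∫ u : ℝ, psi u * oext f (x - b * u) : ℝ) : ℂ) := by
    rw [← integral_complex_ofReal]
    change ∫ u : ℝ, (psi u : ℂ) * F ((x : AddCircle (2 : ℝ)) - ((b * u : ℝ) : AddCircle (2 : ℝ))) = _
    congr 1
    ext u
    rw [← AddCircle.coe_sub, hF, circF_coe]
    push_cast; rfl
  rw [hWx] at H
  have H2 := H.mul_left ((((b ^ 2)⁻¹ : ℝ)) : ℂ)
  rw [← Complex.ofReal_mul] at H2
  rw [← Complex.hasSum_ofReal]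
  refine (congrArg (fun h => HasSum h _) (funext fun ℓ => ?_)).mpr H2
  have hS : ∫ y in (0 : ℝ)..1, f y * sineB (ℓ + 1) y
      = Real.sqrt 2 * ∫ y in (0 : ℝ)..1, f y * Real.sin (π * (ℓ + 1) * y) := by
    rw [← intervalIntegral.integral_const_mul]
    congr 1
    ext y
    simp only [sineB]
    push_cast
    ring
  have hS2 : ∫ y in (0 : ℝ)..1, f y * Real.sin (π * (-(ℓ + 1)) * y)
      = - ∫ y in (0 : ℝ)..1, f y * Real.sin (π * (ℓ + 1) * y) := by
    rw [← intervalIntegral.integral_neg]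
    congr 1
    ext y
    rw [show π * (-((ℓ : ℝ) + 1)) * y = -(π * (ℓ + 1) * y) by ring, Real.sin_neg]
    ring
  rw [hS, hco, hco, circF_coeff h0 h1, circF_coeff h0 h1]
  rw [fourier_coe_apply, fourier_coe_apply]
  push_cast
  rw [hS2]
  generalize (∫ y in (0 : ℝ)..1, f y * Real.sin (π * (ℓ + 1) * y)) = S
  unfold sineB
  push_cast
  rw [Complex.sin]
  have hr : ((Real.sqrt 2 : ℝ) : ℂ) * ((Real.sqrt 2 : ℝ) : ℂ) = 2 := by
    rw [← Complex.ofReal_mul]; norm_num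
  have x1 : (2 * π * Complex.I * (ℓ + 1) * x / 2 : ℂ) = π * (ℓ + 1) * x * Complex.I := by ring
  have x2 : (2 * π * Complex.I * (-(ℓ + 1)) * x / 2 : ℂ) = -(π * (ℓ + 1) * x) * Complex.I := by ring
  have x3 : (-π * (-(ℓ + 1) * b / 2) ^ 2 : ℂ) = -π * ((ℓ + 1) * b / 2) ^ 2 := by ring
  have hb' : (b : ℂ) ≠ 0 := by exact_mod_cast hb.ne'
  simp only [smul_eq_mul]
  rw [x1, x2, x3]
  generalize Complex.exp (-π * ((ℓ + 1) * b / 2) ^ 2) = E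
  generalize Complex.exp (π * (ℓ + 1) * x * Complex.I) = e1
  generalize Complex.exp (-(π * (ℓ + 1) * x) * Complex.I) = e2
  generalize ((Real.sqrt 2 : ℝ) : ℂ) = q at hr
  field_simp
  linear_combination (-2) * E * S * (e2 - e1) * hr


lemma psi_zero : ∫ u : ℝ, psi u = 0 := by
  have := psi_fourier 0
  simp only [mul_zero, Complex.ofReal_zero, zero_mul, Complex.exp_zero, one_mul] at this
  rw [integral_complex_ofReal] at this
  have h := Complex.ofReal_injective this
  rw [h]; simp

lemma kernel_bound {G : ℝ → ℝ} {B a γ : ℝ} (hγ : 0 < γ) (ha : γ < a) (ha1 : a ≤ 2) (hB : 0 ≤ B)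
    (hG : Continuous G) (hH : ∀ x y, |G x - G y| ≤ 2 * B * |x - y| ^ a) {b : ℝ} (hb : 0 < b)
    (x y : ℝ) :
    |(b ^ 2)⁻¹ * (∫ u : ℝ, psi u * G (x - b * u)) - (b ^ 2)⁻¹ * ∫ u : ℝ, psi u * G (y - b * u)|
      ≤ (b ^ 2)⁻¹ * (4 * B * |x - y| ^ γ * b ^ (a - γ) * ∫ u : ℝ, |psi u| * |u| ^ (a - γ)) := by
  have hint : ∀ z, Integrable (fun u => psi u * (G (z - b * u) - G z)) := by
    intro z
    refine ((psi_mul_int (α := a) (by linarith) ha1).const_mul (2 * B * b ^ a)).mono' ?_ ?_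
    · exact (psi_cont.mul ((hG.comp (by fun_prop)).sub continuous_const)).aestronglyMeasurable
    · refine Filter.Eventually.of_forall fun u => ?_
      rw [norm_mul, Real.norm_eq_abs, Real.norm_eq_abs]
      have := hH (z - b * u) z
      rw [show z - b * u - z = -(b * u) by ring, abs_neg, abs_mul, abs_of_pos hb,
        Real.mul_rpow hb.le (abs_nonneg u)] at this
      calc |psi u| * |G (z - b * u) - G z| ≤ |psi u| * (2 * B * (b ^ a * |u| ^ a)) := by gcongr
        _ = _ := by ring
  have hz : ∀ z, ∫ u : ℝ, psi u * G (z - b * u) = ∫ u : ℝ, psi u * (G (z - b * u) - G z) := by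
    intro z
    have h1 := integral_add (hint z) (psi_int.mul_const (G z))
    rw [integral_mul_const, psi_zero, zero_mul, add_zero] at h1
    rw [← h1]
    congr 1
    ext u
    ring
  rw [hz x, hz y, ← mul_sub, ← integral_sub (hint x) (hint y), abs_mul,
    abs_of_pos (by positivity : 0 < (b ^ 2)⁻¹)]
  refine mul_le_mul_of_nonneg_left ?_ (by positivity)
  rw [← integral_const_mul, ← Real.norm_eq_abs]
  refine norm_integral_le_of_norm_le
    ((psi_mul_int (α := a - γ) (by linarith) (by linarith)).const_mul _) ?_
  refine Filter.Eventually.of_forall fun u => ?_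
  rw [← mul_sub, norm_mul, Real.norm_eq_abs, Real.norm_eq_abs]
  have key : |G (x - b * u) - G x - (G (y - b * u) - G y)|
      ≤ 4 * B * (|x - y| ^ γ * |b * u| ^ (a - γ)) := by
    rcases le_total |x - y| |b * u| with h | h
    · have e : |x - y| ^ a ≤ |x - y| ^ γ * |b * u| ^ (a - γ) := by
        calc |x - y| ^ a = |x - y| ^ γ * |x - y| ^ (a - γ) := by
              rw [← Real.rpow_add_of_nonneg (abs_nonneg _) hγ.le (by linarith)]; congr 1; ring
          _ ≤ _ := by
              gcongr
      have p1 := hH (x - b * u) (y - b * u)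
      have p2 := hH x y
      rw [show x - b * u - (y - b * u) = x - y by ring] at p1
      have p3 := abs_sub (G (x - b * u) - G (y - b * u)) (G x - G y)
      rw [show G (x - b * u) - G (y - b * u) - (G x - G y)
        = G (x - b * u) - G x - (G (y - b * u) - G y) by ring] at p3
      have := mul_le_mul_of_nonneg_left e hB
      linarith
    · have e : |b * u| ^ a ≤ |x - y| ^ γ * |b * u| ^ (a - γ) := by
        calc |b * u| ^ a = |b * u| ^ γ * |b * u| ^ (a - γ) := by
              rw [← Real.rpow_add_of_nonneg (abs_nonneg _) hγ.le (by linarith)]; congr 1; ring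
          _ ≤ _ := by
              gcongr
      have p1 := hH (x - b * u) x
      have p2 := hH (y - b * u) y
      rw [show x - b * u - x = -(b * u) by ring, abs_neg] at p1
      rw [show y - b * u - y = -(b * u) by ring, abs_neg] at p2
      have p3 := abs_sub (G (x - b * u) - G x) (G (y - b * u) - G y)
      have := mul_le_mul_of_nonneg_left e hB
      linarith
  rw [abs_mul b u, abs_of_pos hb, Real.mul_rpow hb.le (abs_nonneg u)] at key
  calc _ ≤ |psi u| * (4 * B * (|x - y| ^ γ * (b ^ (a - γ) * |u| ^ (a - γ)))) := by gcongr
    _ = _ := by ring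


noncomputable def exf (ϑ : ℝ) (ℓ : ℕ) (r : ℝ) : ℝ :=
  Real.exp (-(ϑ * Real.pi ^ 2 * ((ℓ : ℝ) + 1) ^ 2 * r))

lemma exf_summable (k : ℕ) {ϑ r : ℝ} (hϑ : 0 < ϑ) (hr : 0 < r) :
    Summable (fun ℓ : ℕ => ((ℓ : ℝ) + 1) ^ k * exf ϑ ℓ r) := by
  have := (summable_nat_add_iff 1).2 (summable_gauss k (q := ϑ * π ^ 2 * r) (by positivity))
  refine this.congr fun ℓ => ?_
  unfold exf
  push_cast
  congr 2
  ring

lemma sineB_le (ℓ : ℕ) (x : ℝ) : |sineB ℓ x| ≤ Real.sqrt 2 := by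
  unfold sineB
  rw [abs_mul, abs_of_nonneg (Real.sqrt_nonneg 2)]
  exact mul_le_of_le_one_right (Real.sqrt_nonneg 2) (Real.abs_sin_le_one _)

lemma coef_le {f : ℝ → ℝ} {B : ℝ} (hb : ∀ x ∈ Set.Icc (0 : ℝ) 1, |f x| ≤ B) (ℓ : ℕ) :
    |∫ y in (0 : ℝ)..1, f y * sineB ℓ y| ≤ Real.sqrt 2 * B := by
  have := intervalIntegral.norm_integral_le_of_norm_le_const (a := (0 : ℝ)) (b := 1)
    (C := Real.sqrt 2 * B) (f := fun y => f y * sineB ℓ y) (by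
      intro y hy
      rw [Set.uIoc_of_le zero_le_one] at hy
      have h1 := hb y ⟨hy.1.le, hy.2⟩
      have h2 := sineB_le ℓ y
      rw [Real.norm_eq_abs, abs_mul, mul_comm]
      gcongr)
  simpa using this

lemma sineB_lip (ℓ : ℕ) (x y : ℝ) : |sineB ℓ x - sineB ℓ y| ≤ Real.sqrt 2 * (π * ℓ * |x - y|) := by
  unfold sineB
  rw [← mul_sub, abs_mul, abs_of_nonneg (Real.sqrt_nonneg 2)]
  gcongr
  have := Real.abs_sin_sub_sin_le (π * ℓ * x) (π * ℓ * y)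
  refine this.trans ?_
  rw [← mul_sub, abs_mul, abs_of_nonneg (by positivity)]

noncomputable def V2 (ϑ : ℝ) (f : ℝ → ℝ) (r x : ℝ) : ℝ :=
  ∑' ℓ : ℕ, -((π * (ℓ + 1)) ^ 2 * exf ϑ ℓ r)
        * (∫ y in (0 : ℝ)..1, f y * sineB (ℓ + 1) y) * sineB (ℓ + 1) x

lemma V2_small {f : ℝ → ℝ} {B a γ ϑ : ℝ} (hϑ : 0 < ϑ) (hγ : 0 < γ) (ha : γ < a) (ha1 : a ≤ 2)
    (hB : 0 ≤ B) (h0 : f 0 = 0) (h1 : f 1 = 0)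
    (hf : ∀ x ∈ Set.Icc (0 : ℝ) 1, ∀ y ∈ Set.Icc (0 : ℝ) 1, |f x - f y| ≤ B * |x - y| ^ a)
    {r : ℝ} (hr : 0 < r) (x y : ℝ) :
    |V2 ϑ f r x - V2 ϑ f r y| ≤ B * ((4 * (4 * π * ϑ) ^ ((a - γ) / 2 - 1) *
      ∫ u : ℝ, |psi u| * |u| ^ (a - γ)) * r ^ ((a - γ) / 2 - 1)) * |x - y| ^ γ := by
  have ha0 : 0 < a := by linarith
  have hc := oext_cont ha0 hB h0 h1 hf
  set b := Real.sqrt (4 * π * ϑ * r) with hb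
  have hp : 0 < 4 * π * ϑ * r := by positivity
  have hb0 : 0 < b := Real.sqrt_pos.2 hp
  have hb2 : b ^ 2 = 4 * π * ϑ * r := Real.sq_sqrt hp.le
  have hV : ∀ z, V2 ϑ f r z = (b ^ 2)⁻¹ * ∫ u : ℝ, psi u * oext f (z - b * u) := by
    intro z
    rw [← (heat_id h0 h1 hc hb0 z).tsum_eq]
    unfold V2 exf
    congr 1
    ext ℓ
    rw [show -π * (((ℓ : ℝ) + 1) * b / 2) ^ 2 = -π * ((ℓ + 1) / 2) ^ 2 * b ^ 2 by ring, hb2]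
    congr 5
    ring
  rw [hV, hV]
  refine (kernel_bound hγ ha ha1 hB hc (oext_holder ha0 hB h0 h1 hf) hb0 x y).trans (le_of_eq ?_)
  have e : (b ^ 2)⁻¹ * b ^ (a - γ) = (4 * π * ϑ) ^ ((a - γ) / 2 - 1) * r ^ ((a - γ) / 2 - 1) := by
    rw [← Real.mul_rpow (by positivity) hr.le, hb2, hb, Real.sqrt_eq_rpow,
      ← Real.rpow_mul hp.le, Real.rpow_sub hp, Real.rpow_one]
    rw [show 1 / 2 * (a - γ) = (a - γ) / 2 by ring]
    field_simp
  linear_combination (4 * B * |x - y| ^ γ * ∫ u : ℝ, |psi u| * |u| ^ (a - γ)) * e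

lemma V2_summable {f : ℝ → ℝ} {B ϑ : ℝ} (hϑ : 0 < ϑ) 
    (hb : ∀ x ∈ Set.Icc (0 : ℝ) 1, |f x| ≤ B) {r : ℝ} (hr : 0 < r) (x : ℝ) :
    Summable (fun ℓ : ℕ => -((π * (ℓ + 1)) ^ 2 * exf ϑ ℓ r)
        * (∫ y in (0 : ℝ)..1, f y * sineB (ℓ + 1) y) * sineB (ℓ + 1) x) := by
  refine Summable.of_norm_bounded ((exf_summable 2 hϑ hr).mul_left
    (π ^ 2 * (Real.sqrt 2 * B) * Real.sqrt 2)) fun ℓ => ?_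
  have h1 := coef_le hb (ℓ + 1)
  have h2 := sineB_le (ℓ + 1) x
  have he : 0 < exf ϑ ℓ r := Real.exp_pos _
  rw [norm_mul, norm_mul, norm_neg, Real.norm_of_nonneg (by positivity), Real.norm_eq_abs,
    Real.norm_eq_abs]
  have hB0 := (abs_nonneg _).trans h1
  calc _ ≤ (π * (ℓ + 1)) ^ 2 * exf ϑ ℓ r * (Real.sqrt 2 * B) * Real.sqrt 2 := by gcongr
    _ = _ := by ring

lemma V2_large {ϑ : ℝ} (hϑ : 0 < ϑ) : ∃ D : ℝ, 0 ≤ D ∧ ∀ (f : ℝ → ℝ) (B γ : ℝ), γ ≤ 1 →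
    (∀ x ∈ Set.Icc (0 : ℝ) 1, |f x| ≤ B) → ∀ r, 1 ≤ r →
    ∀ x ∈ Set.Icc (0 : ℝ) 1, ∀ y ∈ Set.Icc (0 : ℝ) 1,
    |V2 ϑ f r x - V2 ϑ f r y| ≤ B * (D * Real.exp (-(ϑ * π ^ 2 / 2) * r)) * |x - y| ^ γ := by
  have hs := (exf_summable 3 (half_pos hϑ) one_pos).mul_left (2 * π ^ 3)
  refine ⟨∑' ℓ : ℕ, 2 * π ^ 3 * (((ℓ : ℝ) + 1) ^ 3 * exf (ϑ / 2) ℓ 1),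
    tsum_nonneg (fun ℓ => ?_), fun f B γ hγ hb r hr x hx y hy => ?_⟩
  · have : 0 < exf (ϑ / 2) ℓ 1 := Real.exp_pos _
    positivity
  have hr0 : 0 < r := by linarith
  have hB : 0 ≤ B := (abs_nonneg _).trans (hb 0 (by simp))
  unfold V2
  rw [← (V2_summable hϑ hb hr0 x).tsum_sub (V2_summable hϑ hb hr0 y), ← Real.norm_eq_abs]
  have hxy : |x - y| ≤ |x - y| ^ γ := by
    rcases (abs_nonneg (x - y)).eq_or_lt with h | h
    · rw [← h]; positivity
    · have h1 : |x - y| ≤ 1 := by rw [abs_le]; constructor <;> linarith [hx.1, hx.2, hy.1, hy.2]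
      have := Real.rpow_le_rpow_of_exponent_ge h h1 hγ
      rwa [Real.rpow_one] at this
  refine (tsum_of_norm_bounded (hs.mul_left
    (B * Real.exp (-(ϑ * π ^ 2 / 2) * r) * |x - y| ^ γ)).hasSum fun ℓ => ?_).trans (le_of_eq ?_)
  · have h1 := coef_le hb (ℓ + 1)
    have h2 := sineB_lip (ℓ + 1) x y
    have he : 0 < exf ϑ ℓ r := Real.exp_pos _
    have he2 : exf ϑ ℓ r ≤ Real.exp (-(ϑ * π ^ 2 / 2) * r) * exf (ϑ / 2) ℓ 1 := by
      unfold exf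
      rw [← Real.exp_add]
      apply Real.exp_le_exp.2
      have hL : (1 : ℝ) ≤ ((ℓ : ℝ) + 1) ^ 2 := by
        have : (0 : ℝ) ≤ ℓ := ℓ.cast_nonneg
        nlinarith
      have : r + ((ℓ : ℝ) + 1) ^ 2 ≤ 2 * (((ℓ : ℝ) + 1) ^ 2 * r) := by nlinarith
      have hc : 0 < ϑ * π ^ 2 / 2 := by positivity
      nlinarith
    have he3 : 0 < exf (ϑ / 2) ℓ 1 := Real.exp_pos _
    rw [← mul_sub, norm_mul, norm_mul, norm_neg, Real.norm_of_nonneg (by positivity),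
      Real.norm_eq_abs, Real.norm_eq_abs]
    push_cast at h2
    calc _ ≤ (π * (ℓ + 1)) ^ 2 * (Real.exp (-(ϑ * π ^ 2 / 2) * r) * exf (ϑ / 2) ℓ 1)
          * (Real.sqrt 2 * B) * (Real.sqrt 2 * (π * (ℓ + 1) * |x - y| ^ γ)) := by
            gcongr
            exact h2.trans (by gcongr)
      _ = Real.sqrt 2 ^ 2 * (π ^ 3 * (((ℓ : ℝ) + 1) ^ 3 * exf (ϑ / 2) ℓ 1)) *
          (B * Real.exp (-(ϑ * π ^ 2 / 2) * r) * |x - y| ^ γ) := by ring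
      _ = _ := by rw [Real.sq_sqrt (by norm_num)]; ring
  · rw [tsum_mul_left]; ring

lemma V2_bound {ϑ a γ : ℝ} (hϑ : 0 < ϑ) (hγ : 0 < γ) (ha : γ < a) (ha1 : a ≤ 1) :
    ∃ k : ℝ → ℝ, IntegrableOn k (Set.Ioi 0) ∧ (∀ r, 0 < r → 0 ≤ k r) ∧
    ∀ (f : ℝ → ℝ) (B : ℝ), f 0 = 0 → f 1 = 0 → (∀ x ∈ Set.Icc (0 : ℝ) 1, |f x| ≤ B) →
    (∀ x ∈ Set.Icc (0 : ℝ) 1, ∀ y ∈ Set.Icc (0 : ℝ) 1, |f x - f y| ≤ B * |x - y| ^ a) →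
    ∀ r, 0 < r → ∀ x ∈ Set.Icc (0 : ℝ) 1, ∀ y ∈ Set.Icc (0 : ℝ) 1,
    |V2 ϑ f r x - V2 ϑ f r y| ≤ B * k r * |x - y| ^ γ := by
  obtain ⟨D, hD, hL⟩ := V2_large hϑ
  set M := ∫ u : ℝ, |psi u| * |u| ^ (a - γ) with hM
  have hM0 : 0 ≤ M := integral_nonneg fun u => by positivity
  set A := 4 * (4 * π * ϑ) ^ ((a - γ) / 2 - 1) * M with hA
  have hA0 : 0 ≤ A := by positivity
  set k1 : ℝ → ℝ := (Set.Ioc (0 : ℝ) 1).indicator (fun r => A * r ^ ((a - γ) / 2 - 1)) with hk1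
  have hk1n : ∀ r, 0 ≤ k1 r := fun r => Set.indicator_nonneg (fun r hr => by
    have := hr.1
    positivity) r
  refine ⟨fun r => k1 r + D * Real.exp (-(ϑ * π ^ 2 / 2) * r), ?_, ?_, ?_⟩
  · refine Integrable.add ?_ ?_
    · refine Integrable.integrableOn ?_
      rw [hk1, integrable_indicator_iff measurableSet_Ioc]
      have := intervalIntegral.intervalIntegrable_rpow' (a := 0) (b := 1)
        (r := (a - γ) / 2 - 1) (by linarith)
      rw [intervalIntegrable_iff_integrableOn_Ioc_of_le zero_le_one] at this
      exact this.const_mul A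
    · exact (exp_neg_integrableOn_Ioi 0 (by positivity)).const_mul D
  · intro r hr
    have := hk1n r
    positivity
  · intro f B h0 h1 hb hf r hr x hx y hy
    have hB : 0 ≤ B := (abs_nonneg _).trans (hb 0 (by simp))
    rcases le_total r 1 with h | h
    · refine (V2_small hϑ hγ ha (by linarith) hB h0 h1 hf hr x y).trans ?_
      gcongr
      have hrm : r ∈ Set.Ioc (0 : ℝ) 1 := ⟨hr, h⟩
      have : k1 r = A * r ^ ((a - γ) / 2 - 1) := by rw [hk1, Set.indicator_of_mem hrm]
      change A * r ^ ((a - γ) / 2 - 1) ≤ k1 r + D * Real.exp (-(ϑ * π ^ 2 / 2) * r)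
      rw [this]
      have := Real.exp_pos (-(ϑ * π ^ 2 / 2) * r)
      nlinarith [mul_nonneg hD this.le]
    · refine (hL f B γ (by linarith) hb r h x hx y hy).trans ?_
      gcongr
      change D * Real.exp (-(ϑ * π ^ 2 / 2) * r) ≤ k1 r + D * Real.exp (-(ϑ * π ^ 2 / 2) * r)
      linarith [hk1n r]


noncomputable def V0 (ϑ : ℝ) (f : ℝ → ℝ) (r x : ℝ) : ℝ :=
  ∑' ℓ : ℕ, exf ϑ ℓ r * (∫ y in (0 : ℝ)..1, f y * sineB (ℓ + 1) y) * sineB (ℓ + 1) x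

noncomputable def V1 (ϑ : ℝ) (f : ℝ → ℝ) (r x : ℝ) : ℝ :=
  ∑' ℓ : ℕ, exf ϑ ℓ r * (∫ y in (0 : ℝ)..1, f y * sineB (ℓ + 1) y)
    * (Real.sqrt 2 * (Real.cos (π * (ℓ + 1) * x) * (π * (ℓ + 1))))

lemma V0_deriv {f : ℝ → ℝ} {B ϑ : ℝ} (hϑ : 0 < ϑ)
    (hb : ∀ x ∈ Set.Icc (0 : ℝ) 1, |f x| ≤ B) {r : ℝ} (hr : 0 < r) (x : ℝ) :
    HasDerivAt (V0 ϑ f r) (V1 ϑ f r x) x := by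
  unfold V0 V1
  refine hasDerivAt_tsum (𝕜 := ℝ) (F := ℝ) (y₀ := (0 : ℝ))
    (g := fun (ℓ : ℕ) (x : ℝ) => exf ϑ ℓ r * (∫ y in (0 : ℝ)..1, f y * sineB (ℓ + 1) y) * sineB (ℓ + 1) x)
    (g' := fun (ℓ : ℕ) (x : ℝ) => exf ϑ ℓ r * (∫ y in (0 : ℝ)..1, f y * sineB (ℓ + 1) y)
      * (Real.sqrt 2 * (Real.cos (π * (ℓ + 1) * x) * (π * (ℓ + 1))))) ((exf_summable 1 hϑ hr).mul_left
    ((Real.sqrt 2 * B) * Real.sqrt 2 * π)) (fun ℓ y => ?_) (fun ℓ y => ?_) ?_ x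
  · refine HasDerivAt.const_mul _ ?_
    unfold sineB
    refine HasDerivAt.const_mul _ ?_
    push_cast
    have := ((hasDerivAt_id' y).const_mul (π * ((ℓ : ℝ) + 1))).sin
    simpa using this
  · have h1 := coef_le hb (ℓ + 1)
    have he : 0 < exf ϑ ℓ r := Real.exp_pos _
    have hc := Real.abs_cos_le_one (π * (ℓ + 1) * y)
    have hB0 := (abs_nonneg _).trans h1
    rw [Real.norm_eq_abs, abs_mul, abs_mul, abs_mul, abs_mul, abs_of_pos he,
      abs_of_nonneg (Real.sqrt_nonneg 2), abs_of_nonneg (by positivity : 0 ≤ π * ((ℓ : ℝ) + 1))]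
    calc _ ≤ exf ϑ ℓ r * (Real.sqrt 2 * B) * (Real.sqrt 2 * (1 * (π * (ℓ + 1)))) := by gcongr
      _ = _ := by ring
  · simp [sineB, summable_zero]

lemma V1_deriv {f : ℝ → ℝ} {B ϑ : ℝ} (hϑ : 0 < ϑ)
    (hb : ∀ x ∈ Set.Icc (0 : ℝ) 1, |f x| ≤ B) {r : ℝ} (hr : 0 < r) (x : ℝ) :
    HasDerivAt (V1 ϑ f r) (V2 ϑ f r x) x := by
  unfold V1 V2
  refine hasDerivAt_tsum (𝕜 := ℝ) (F := ℝ) (y₀ := (0 : ℝ))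
    (g := fun (ℓ : ℕ) (x : ℝ) => exf ϑ ℓ r * (∫ y in (0 : ℝ)..1, f y * sineB (ℓ + 1) y)
      * (Real.sqrt 2 * (Real.cos (π * (ℓ + 1) * x) * (π * (ℓ + 1)))))
    (g' := fun (ℓ : ℕ) (x : ℝ) => -((π * (ℓ + 1)) ^ 2 * exf ϑ ℓ r) *
      (∫ y in (0 : ℝ)..1, f y * sineB (ℓ + 1) y) * sineB (ℓ + 1) x) ((exf_summable 2 hϑ hr).mul_left
    ((Real.sqrt 2 * B) * Real.sqrt 2 * π ^ 2)) (fun ℓ y => ?_) (fun ℓ y => ?_) ?_ x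
  · have := (((((hasDerivAt_id' y).const_mul (π * ((ℓ : ℝ) + 1))).cos).mul_const
      (π * ((ℓ : ℝ) + 1))).const_mul (Real.sqrt 2)).const_mul
      (exf ϑ ℓ r * (∫ y in (0 : ℝ)..1, f y * sineB (ℓ + 1) y))
    refine HasDerivAt.congr_deriv this ?_
    simp only [sineB]
    push_cast
    ring
  · have h1 := coef_le hb (ℓ + 1)
    have h2 := sineB_le (ℓ + 1) y
    have he : 0 < exf ϑ ℓ r := Real.exp_pos _
    rw [norm_mul, norm_mul, norm_neg, Real.norm_of_nonneg (by positivity), Real.norm_eq_abs,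
      Real.norm_eq_abs]
    have hB0 := (abs_nonneg _).trans h1
    calc _ ≤ (π * (ℓ + 1)) ^ 2 * exf ϑ ℓ r * (Real.sqrt 2 * B) * Real.sqrt 2 := by gcongr
      _ = _ := by ring
  · refine Summable.of_norm_bounded ((exf_summable 1 hϑ hr).mul_left
      ((Real.sqrt 2 * B) * Real.sqrt 2 * π)) fun ℓ => ?_
    have h1 := coef_le hb (ℓ + 1)
    have he : 0 < exf ϑ ℓ r := Real.exp_pos _
    have hB0 := (abs_nonneg _).trans h1
    rw [mul_zero, Real.cos_zero, Real.norm_eq_abs, abs_mul, abs_mul, abs_mul, abs_mul, abs_of_pos he,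
      abs_of_nonneg (Real.sqrt_nonneg 2), abs_of_nonneg (by positivity : 0 ≤ π * ((ℓ : ℝ) + 1)), abs_one]
    calc _ ≤ exf ϑ ℓ r * (Real.sqrt 2 * B) * (Real.sqrt 2 * (1 * (π * (ℓ + 1)))) := by gcongr
      _ = _ := by ring

lemma V0_zero (ϑ : ℝ) (f : ℝ → ℝ) (r : ℝ) : V0 ϑ f r 0 = 0 := by simp [V0, sineB]

lemma V2_zero (ϑ : ℝ) (f : ℝ → ℝ) (r : ℝ) : V2 ϑ f r 0 = 0 := by simp [V2, sineB]

lemma V0_one (ϑ : ℝ) (f : ℝ → ℝ) (r : ℝ) : V0 ϑ f r 1 = 0 := by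
  have : ∀ ℓ : ℕ, sineB (ℓ + 1) 1 = 0 := by
    intro ℓ
    unfold sineB
    rw [mul_one, mul_comm π, Real.sin_nat_mul_pi, mul_zero]
  simp [V0, this]

lemma abs_int {μ : Measure ℝ} {v K : ℝ → ℝ} {c : ℝ} (hK : Integrable K μ)
    (h : ∀ᵐ s ∂μ, |v s| ≤ K s * c) : |∫ s, v s ∂μ| ≤ (∫ s, K s ∂μ) * c := by
  rw [← integral_mul_const, ← Real.norm_eq_abs]
  exact norm_integral_le_of_norm_le (hK.mul_const c) h

lemma abstract_int {μ : Measure ℝ} {v0 v1 v2 : ℝ → ℝ → ℝ} {K : ℝ → ℝ} {γ : ℝ} (hγ : 0 < γ)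
    (hK : Integrable K μ)
    (m0 : ∀ x, AEMeasurable (fun s => v0 s x) μ) (m1 : ∀ x, AEMeasurable (fun s => v1 s x) μ)
    (m2 : ∀ x, AEMeasurable (fun s => v2 s x) μ)
    (hgood : ∀ᵐ s ∂μ, 0 ≤ K s ∧ (∀ x, HasDerivAt (v0 s) (v1 s x) x) ∧
      (∀ x, HasDerivAt (v1 s) (v2 s x) x) ∧ v0 s 0 = 0 ∧ v0 s 1 = 0 ∧ v2 s 0 = 0 ∧
      ∀ x ∈ Set.Icc (0 : ℝ) 1, ∀ y ∈ Set.Icc (0 : ℝ) 1, |v2 s x - v2 s y| ≤ K s * |x - y| ^ γ) :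
    let N := fun x => ∫ s, v0 s x ∂μ
    let I := ∫ s, K s ∂μ
    (∀ x ∈ Set.Ioo (0 : ℝ) 1, DifferentiableAt ℝ N x) ∧
    (∀ x ∈ Set.Ioo (0 : ℝ) 1, DifferentiableAt ℝ (deriv N) x) ∧
    ContinuousOn (deriv (deriv N)) (Set.Ioo 0 1) ∧
    (∀ x ∈ Set.Ioo (0 : ℝ) 1, |deriv (deriv N) x| ≤ I) ∧
    (∀ x ∈ Set.Ioo (0 : ℝ) 1, ∀ y ∈ Set.Ioo (0 : ℝ) 1,
      |deriv (deriv N) x - deriv (deriv N) y| ≤ I * |x - y| ^ γ) := by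
  intro N I
  have b2 : ∀ᵐ s ∂μ, ∀ x ∈ Set.Icc (0 : ℝ) 1, |v2 s x| ≤ K s := by
    filter_upwards [hgood] with s ⟨h0, _, _, _, _, hz, hh⟩ x hx
    have := hh x hx 0 (by simp)
    rw [hz, sub_zero, sub_zero, abs_of_nonneg hx.1] at this
    exact this.trans (mul_le_of_le_one_right h0 (Real.rpow_le_one hx.1 hx.2 hγ.le))
  have b1 : ∀ᵐ s ∂μ, ∀ x ∈ Set.Icc (0 : ℝ) 1, |v1 s x| ≤ K s := by
    filter_upwards [hgood, b2] with s ⟨h0, d0, d1, z0, z1, _⟩ hb x hx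
    obtain ⟨ξ, hξ, hz⟩ := exists_hasDerivAt_eq_zero (f := v0 s) (f' := v1 s) zero_lt_one
      (fun x _ => (d0 x).continuousAt.continuousWithinAt) (by rw [z0, z1]) (fun x _ => d0 x)
    have := (convex_Icc (0 : ℝ) 1).norm_image_sub_le_of_norm_hasDerivWithin_le
      (f := v1 s) (f' := v2 s) (C := K s) (fun x _ => (d1 x).hasDerivWithinAt) hb
      ⟨hξ.1.le, hξ.2.le⟩ hx
    rw [hz, sub_zero, Real.norm_eq_abs, Real.norm_eq_abs] at this
    refine this.trans (mul_le_of_le_one_right h0 ?_)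
    rw [abs_le]; constructor <;> linarith [hξ.1, hξ.2, hx.1, hx.2]
  have b0 : ∀ᵐ s ∂μ, ∀ x ∈ Set.Icc (0 : ℝ) 1, |v0 s x| ≤ K s := by
    filter_upwards [hgood, b1] with s ⟨h0, d0, d1, z0, z1, _⟩ hb x hx
    have := (convex_Icc (0 : ℝ) 1).norm_image_sub_le_of_norm_hasDerivWithin_le
      (f := v0 s) (f' := v1 s) (C := K s) (fun x _ => (d0 x).hasDerivWithinAt) hb
      (by simp : (0 : ℝ) ∈ Set.Icc (0 : ℝ) 1) hx
    rw [z0, sub_zero, sub_zero, Real.norm_eq_abs, Real.norm_eq_abs] at this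
    refine this.trans (mul_le_of_le_one_right h0 ?_)
    rw [abs_le]; constructor <;> linarith [hx.1, hx.2]
  have hnb : ∀ x ∈ Set.Ioo (0 : ℝ) 1, Set.Ioo (0 : ℝ) 1 ∈ nhds x :=
    fun x hx => isOpen_Ioo.mem_nhds hx
  have sub : ∀ x ∈ Set.Ioo (0 : ℝ) 1, x ∈ Set.Icc (0 : ℝ) 1 := fun x hx => Set.Ioo_subset_Icc_self hx
  have D0 : ∀ x ∈ Set.Ioo (0 : ℝ) 1, HasDerivAt N (∫ s, v1 s x ∂μ) x := by
    intro x hx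
    refine (hasDerivAt_integral_of_dominated_loc_of_deriv_le (F := fun x s => v0 s x)
      (F' := fun x s => v1 s x) (bound := K) (hnb x hx) ?_ ?_ ?_ ?_ hK ?_).2
    · exact Filter.Eventually.of_forall fun z => (m0 z).aestronglyMeasurable
    · exact hK.mono' (m0 x).aestronglyMeasurable (b0.mono fun s h => h x (sub x hx))
    · exact (m1 x).aestronglyMeasurable
    · exact b1.mono fun s h z hz => h z (sub z hz)
    · exact hgood.mono fun s h z _ => h.2.1 z
  have D1 : ∀ x ∈ Set.Ioo (0 : ℝ) 1,
      HasDerivAt (fun z => ∫ s, v1 s z ∂μ) (∫ s, v2 s x ∂μ) x := by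
    intro x hx
    refine (hasDerivAt_integral_of_dominated_loc_of_deriv_le (F := fun x s => v1 s x)
      (F' := fun x s => v2 s x) (bound := K) (hnb x hx) ?_ ?_ ?_ ?_ hK ?_).2
    · exact Filter.Eventually.of_forall fun z => (m1 z).aestronglyMeasurable
    · exact hK.mono' (m1 x).aestronglyMeasurable (b1.mono fun s h => h x (sub x hx))
    · exact (m2 x).aestronglyMeasurable
    · exact b2.mono fun s h z hz => h z (sub z hz)
    · exact hgood.mono fun s h z _ => h.2.2.1 z
  have D2 : ∀ x ∈ Set.Ioo (0 : ℝ) 1, HasDerivAt (deriv N) (∫ s, v2 s x ∂μ) x := by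
    intro x hx
    refine (D1 x hx).congr_of_eventuallyEq ?_
    filter_upwards [hnb x hx] with z hz
    exact (D0 z hz).deriv
  have E2 : ∀ x ∈ Set.Ioo (0 : ℝ) 1, deriv (deriv N) x = ∫ s, v2 s x ∂μ :=
    fun x hx => (D2 x hx).deriv
  have i2 : ∀ x ∈ Set.Ioo (0 : ℝ) 1, Integrable (fun s => v2 s x) μ := fun x hx =>
    hK.mono' (m2 x).aestronglyMeasurable (b2.mono fun s h => h x (sub x hx))
  have hol : ∀ x ∈ Set.Ioo (0 : ℝ) 1, ∀ y ∈ Set.Ioo (0 : ℝ) 1,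
      |deriv (deriv N) x - deriv (deriv N) y| ≤ I * |x - y| ^ γ := by
    intro x hx y hy
    rw [E2 x hx, E2 y hy, ← integral_sub (i2 x hx) (i2 y hy)]
    exact abs_int hK (hgood.mono fun s h => h.2.2.2.2.2.2 x (sub x hx) y (sub y hy))
  refine ⟨fun x hx => (D0 x hx).differentiableAt, fun x hx => (D2 x hx).differentiableAt, ?_, ?_, hol⟩
  · intro x hx
    rw [ContinuousWithinAt, tendsto_iff_dist_tendsto_zero]
    have hc : Continuous (fun y : ℝ => I * |y - x| ^ γ) :=
      continuous_const.mul (((continuous_id.sub continuous_const).abs).rpow_const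
        (fun _ => Or.inr hγ.le))
    have ht := (hc.tendsto x).mono_left (nhdsWithin_le_nhds (s := Set.Ioo (0 : ℝ) 1))
    simp only [sub_self, abs_zero, Real.zero_rpow hγ.ne', mul_zero] at ht
    refine squeeze_zero' (Filter.Eventually.of_forall fun _ => dist_nonneg) ?_ ht
    filter_upwards [self_mem_nhdsWithin] with y hy
    exact hol y hy x hx
  · intro x hx
    rw [E2 x hx]
    have := abs_int (c := 1) hK (b2.mono fun s h => by simpa using h x (sub x hx))
    simpa using this


lemma coef_aem {g : ℝ → ℝ → ℝ}
    (hg : ContinuousOn (fun q : ℝ × ℝ => g q.1 q.2) (Set.Ici 0 ×ˢ Set.Icc 0 1)) (ℓ : ℕ) (t : ℝ) :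
    AEMeasurable (fun s => ∫ y in (0 : ℝ)..1, g s y * sineB ℓ y)
      (volume.restrict (Set.Ioo 0 t)) := by
  have hc : Continuous (fun q : ℝ × ℝ => g (max q.1 0) (max 0 (min q.2 1))) := by
    refine hg.comp_continuous (f := fun q : ℝ × ℝ => (max q.1 0, max 0 (min q.2 1)))
      (by fun_prop) fun q => ?_
    refine ⟨?_, ?_, ?_⟩
    · simp
    · simp
    · simp
  have hcont : Continuous (fun s => ∫ y in (0 : ℝ)..1, g (max s 0) (max 0 (min y 1)) * sineB ℓ y) := by
    refine intervalIntegral.continuous_parametric_intervalIntegral_of_continuous' ?_ 0 1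
    have hs : Continuous (fun q : ℝ × ℝ => sineB ℓ q.2) := by unfold sineB; fun_prop
    exact hc.mul hs
  refine hcont.measurable.aemeasurable.congr ?_
  refine (ae_restrict_iff' measurableSet_Ioo).2 (Filter.Eventually.of_forall fun s hs => ?_)
  refine intervalIntegral.integral_congr fun y hy => ?_
  rw [Set.uIcc_of_le zero_le_one] at hy
  rw [max_eq_left hs.1.le, min_eq_left hy.2, max_eq_right hy.1]

lemma exf_aem (ϑ t : ℝ) (ℓ : ℕ) (μ : Measure ℝ) : AEMeasurable (fun s => exf ϑ ℓ (t - s)) μ := by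
  have : Continuous (fun s => exf ϑ ℓ (t - s)) := by unfold exf; fun_prop
  exact this.measurable.aemeasurable

/-- Excess spatial regularity of the heat convolution of a spatially `γ̃`-Hölder continuous,
bounded `g` vanishing on the lateral boundary: for every `γ ∈ (0, γ̃)` there is a constant
`C = C(γ, γ̃, ϑ)` such that for every `t ≥ 0` the map `x ↦ N(t,x)` is twice continuously
differentiable on `(0,1)` with `|∂²ₓN(t,x)| ≤ C·B` and
`|∂²ₓN(t,x) − ∂²ₓN(t,y)| ≤ C·B·|x−y|^γ`. -/
theorem heatConv_second_space_derivative_hoelder (ϑ γ' : ℝ) (hϑ : 0 < ϑ)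
    (hγ' : γ' ∈ Set.Ioo (0 : ℝ) (1 / 2)) (γ : ℝ) (hγ : γ ∈ Set.Ioo (0 : ℝ) γ') :
    ∃ C > (0 : ℝ), ∀ (g : ℝ → ℝ → ℝ) (B : ℝ),
      ContinuousOn (fun q : ℝ × ℝ => g q.1 q.2) (Set.Ici 0 ×ˢ Set.Icc 0 1) →
      (∀ s : ℝ, 0 ≤ s → g s 0 = 0 ∧ g s 1 = 0) →
      (∀ s : ℝ, 0 ≤ s → ∀ x ∈ Set.Icc (0 : ℝ) 1, |g s x| ≤ B) →
      (∀ s : ℝ, 0 ≤ s → ∀ x ∈ Set.Icc (0 : ℝ) 1, ∀ y ∈ Set.Icc (0 : ℝ) 1,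
        |g s x - g s y| ≤ B * |x - y| ^ γ') →
      ∀ t : ℝ, 0 ≤ t →
        (∀ x ∈ Set.Ioo (0 : ℝ) 1, DifferentiableAt ℝ (fun z => heatConv ϑ g t z) x) ∧
        (∀ x ∈ Set.Ioo (0 : ℝ) 1,
          DifferentiableAt ℝ (deriv (fun z => heatConv ϑ g t z)) x) ∧
        ContinuousOn (deriv (deriv (fun z => heatConv ϑ g t z))) (Set.Ioo 0 1) ∧
        (∀ x ∈ Set.Ioo (0 : ℝ) 1,
          |deriv (deriv (fun z => heatConv ϑ g t z)) x| ≤ C * B) ∧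
        (∀ x ∈ Set.Ioo (0 : ℝ) 1, ∀ y ∈ Set.Ioo (0 : ℝ) 1,
          |deriv (deriv (fun z => heatConv ϑ g t z)) x
              - deriv (deriv (fun z => heatConv ϑ g t z)) y| ≤ C * B * |x - y| ^ γ) := by
  obtain ⟨k, hki, hk0, hk⟩ := V2_bound (a := γ') hϑ hγ.1 hγ.2 (by linarith [hγ'.2])
  have hI0 : 0 ≤ ∫ r in Set.Ioi 0, k r :=
    setIntegral_nonneg measurableSet_Ioi fun r hr => hk0 r hr
  refine ⟨(∫ r in Set.Ioi 0, k r) + 1, by linarith, ?_⟩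
  intro g B hg hz hb hh t ht
  have hB : 0 ≤ B := (abs_nonneg _).trans (hb 0 le_rfl 0 (by simp))
  have hki' : IntervalIntegrable k volume 0 t := by
    rw [intervalIntegrable_iff_integrableOn_Ioc_of_le ht]
    exact hki.mono_set Set.Ioc_subset_Ioi_self
  have hK : Integrable (fun s => B * k (t - s)) (volume.restrict (Set.Ioo 0 t)) := by
    have := (hki'.comp_sub_left t).symm
    rw [sub_self, sub_zero, intervalIntegrable_iff_integrableOn_Ioo_of_le ht] at this
    exact this.const_mul B
  have hKI : ∫ s in Set.Ioo 0 t, B * k (t - s) ≤ ((∫ r in Set.Ioi 0, k r) + 1) * B := by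
    rw [integral_const_mul, mul_comm]
    refine mul_le_mul_of_nonneg_right ?_ hB
    rw [← integral_Ioc_eq_integral_Ioo, ← intervalIntegral.integral_of_le ht,
      intervalIntegral.integral_comp_sub_left (fun r => k r) t, sub_self, sub_zero,
      intervalIntegral.integral_of_le ht]
    have : ∫ r in Set.Ioc 0 t, k r ≤ ∫ r in Set.Ioi 0, k r :=
      setIntegral_mono_set hki
        ((ae_restrict_iff' measurableSet_Ioi).2 (Filter.Eventually.of_forall fun r hr => hk0 r hr))
        (Filter.Eventually.of_forall fun r hr => hr.1)
    linarith
  have hN : (fun z => heatConv ϑ g t z) =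
      fun z => ∫ s in Set.Ioo 0 t, V0 ϑ (g s) (t - s) z := by
    funext z
    unfold heatConv V0 exf fCoef
    rw [intervalIntegral.integral_of_le ht, integral_Ioc_eq_integral_Ioo]
  have key := abstract_int (μ := volume.restrict (Set.Ioo 0 t))
    (v0 := fun s x => V0 ϑ (g s) (t - s) x) (v1 := fun s x => V1 ϑ (g s) (t - s) x)
    (v2 := fun s x => V2 ϑ (g s) (t - s) x) (K := fun s => B * k (t - s)) hγ.1 hK
    (fun x => AEMeasurable.tsum fun ℓ =>
      ((exf_aem ϑ t ℓ _).mul (coef_aem hg (ℓ + 1) t)).mul_const _)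
    (fun x => AEMeasurable.tsum fun ℓ =>
      ((exf_aem ϑ t ℓ _).mul (coef_aem hg (ℓ + 1) t)).mul_const _)
    (fun x => AEMeasurable.tsum fun ℓ =>
      ((((exf_aem ϑ t ℓ _).const_mul _).neg).mul (coef_aem hg (ℓ + 1) t)).mul_const _)
    ((ae_restrict_iff' measurableSet_Ioo).2 (Filter.Eventually.of_forall fun s hs => by
      have h0 : 0 ≤ s := hs.1.le
      have hr : 0 < t - s := sub_pos.2 hs.2
      exact ⟨mul_nonneg hB (hk0 _ hr), fun x => V0_deriv hϑ (hb s h0) hr x,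
        fun x => V1_deriv hϑ (hb s h0) hr x, V0_zero _ _ _, V0_one _ _ _, V2_zero _ _ _,
        fun x hx y hy => hk (g s) B (hz s h0).1 (hz s h0).2 (hb s h0) (hh s h0) _ hr x hx y hy⟩))
  rw [hN]
  obtain ⟨k1, k2, k3, k4, k5⟩ := key
  refine ⟨k1, k2, k3, fun x hx => (k4 x hx).trans hKI, fun x hx y hy => (k5 x hx y hy).trans ?_⟩
  exact mul_le_mul_of_nonneg_right hKI (by positivity)
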